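/- arXiv:2106.05396 — 2 statements merged into one kernel-verified Lean document; each statement's English description precedes it below -/
import Mathlib

section
/- (Existence of a coverage-matching amplitude, lower-quantile case.) Assume Hypothesis H2, σ_ε² > 0, a ∈ (0, 1/2), q < 0, and 0 < δ < −q. Set k_ε = Card{ i ∈ {1,…,n} : (Πy)ᵢ/√(Πᵢᵢ) ≤ σ_ε q }. If k_ε > na, then there exists σ² ∈ (0,∞) such that ψ⁻_δ(σ²) = a. -/
open Matrix

/-- The matrix `K̄ = K⁻¹ − K⁻¹F(FᵀK⁻¹F)⁻¹FᵀK⁻¹`. -/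
noncomputable def Kbar {n p : ℕ} (F : Matrix (Fin n) (Fin p) ℝ)
    (K : Matrix (Fin n) (Fin n) ℝ) : Matrix (Fin n) (Fin n) ℝ :=
  K⁻¹ - K⁻¹ * F * (Fᵀ * K⁻¹ * F)⁻¹ * Fᵀ * K⁻¹

/-- `h⁻_δ(x) = 1` if `x ≥ 0`, `1 + x/δ` if `−δ ≤ x < 0`, `0` if `x < −δ`. -/
noncomputable def hminus (δ x : ℝ) : ℝ :=
  if 0 ≤ x then 1 else if -δ ≤ x then 1 + x / δ else 0

/-- `ψ⁻_δ(K) = (1/n) Σᵢ h⁻_δ(q − (K̄y)ᵢ/√(K̄ᵢᵢ))`. -/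
noncomputable def psiMinus {n p : ℕ} (F : Matrix (Fin n) (Fin p) ℝ)
    (y : Fin n → ℝ) (δ q : ℝ) (K : Matrix (Fin n) (Fin n) ℝ) : ℝ :=
  (1 / n) * ∑ i, hminus δ (q - (Kbar F K *ᵥ y) i / Real.sqrt (Kbar F K i i))

theorem continuous_hminus {δ : ℝ} (hδ : 0 < δ) : Continuous (hminus δ) := by
  have h : hminus δ = fun x => max 0 (min 1 (1 + x / δ)) := by
    funext x
    unfold hminus
    split_ifs with h0 h1
    · have : 0 ≤ x / δ := div_nonneg h0 hδ.le
      rw [min_eq_left (by linarith), max_eq_right zero_le_one]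
    · have h2 : x / δ ≤ 0 := div_nonpos_of_nonpos_of_nonneg (by linarith) hδ.le
      have h3 : -1 ≤ x / δ := by rw [le_div_iff₀ hδ]; linarith
      rw [min_eq_right (by linarith), max_eq_right (by linarith)]
    · have h3 : x / δ ≤ -1 := by rw [div_le_iff₀ hδ]; linarith
      rw [min_eq_right (by linarith), max_eq_left (by linarith)]
  rw [h]
  fun_prop

theorem hminus_nonneg {δ : ℝ} (hδ : 0 < δ) (x : ℝ) : 0 ≤ hminus δ x := by
  unfold hminus
  split_ifs with h0 h1
  · exact zero_le_one
  · have h3 : -1 ≤ x / δ := by rw [le_div_iff₀ hδ]; linarith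
    linarith
  · exact le_rfl

theorem ContinuousAt.matrix_mul {X l m n : Type*} [TopologicalSpace X] [Fintype m]
    {A : X → Matrix l m ℝ} {B : X → Matrix m n ℝ} {x : X}
    (hA : ContinuousAt A x) (hB : ContinuousAt B x) : ContinuousAt (fun t => A t * B t) x :=
  ((continuous_fst.matrix_mul continuous_snd :
    Continuous fun P : Matrix l m ℝ × Matrix m n ℝ => P.1 * P.2).continuousAt).comp
      (hA.prodMk hB)

theorem Matrix.PosDef.continuousAt_inv {n : Type*} [Fintype n] [DecidableEq n]
    {A : Matrix n n ℝ} (hA : A.PosDef) : ContinuousAt Inv.inv A := by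
  refine continuousAt_matrix_inv A ?_
  rw [Ring.inverse_eq_inv']
  exact continuousAt_inv₀ hA.det_pos.ne'

theorem mulVec_injective_of_rank_eq {n p : ℕ} {F : Matrix (Fin n) (Fin p) ℝ}
    (hF : F.rank = p) : Function.Injective F.mulVec := by
  have h := LinearMap.finrank_range_add_finrank_ker F.mulVecLin
  rw [show Module.finrank ℝ (LinearMap.range F.mulVecLin) = p from hF, Module.finrank_fin_fun] at h
  have hk : Module.finrank ℝ (LinearMap.ker F.mulVecLin) = 0 := by omega
  exact LinearMap.ker_eq_bot.mp (Submodule.finrank_eq_zero.mp hk)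

section Kbar

variable {n p : ℕ} {F : Matrix (Fin n) (Fin p) ℝ} {K : Matrix (Fin n) (Fin n) ℝ}

theorem posDef_transpose_mul_inv_mul (hF : F.rank = p) (hK : K.PosDef) :
    (Fᵀ * K⁻¹ * F).PosDef := by
  have h := hK.inv.conjTranspose_mul_mul_same (mulVec_injective_of_rank_eq hF)
  rwa [conjTranspose_eq_transpose_of_trivial] at h

theorem continuousAt_Kbar (hF : F.rank = p) (hK : K.PosDef) : ContinuousAt (Kbar F) K := by
  have h1 : ContinuousAt (fun K : Matrix (Fin n) (Fin n) ℝ => K⁻¹) K := hK.continuousAt_inv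
  have h2 : ContinuousAt (fun K : Matrix (Fin n) (Fin n) ℝ => (Fᵀ * K⁻¹ * F)⁻¹) K :=
    ContinuousAt.comp (f := fun K : Matrix (Fin n) (Fin n) ℝ => Fᵀ * K⁻¹ * F) (g := Inv.inv)
      (posDef_transpose_mul_inv_mul hF hK).continuousAt_inv
      ((continuousAt_const.matrix_mul h1).matrix_mul continuousAt_const)
  exact h1.sub ((((h1.matrix_mul continuousAt_const).matrix_mul h2).matrix_mul
    continuousAt_const).matrix_mul h1)

theorem Kbar_eq_transpose_mul_mul (hF : F.rank = p) (hK : K.PosDef) :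
    Kbar F K = (1 - F * (Fᵀ * K⁻¹ * F)⁻¹ * Fᵀ * K⁻¹)ᵀ * K⁻¹ *
      (1 - F * (Fᵀ * K⁻¹ * F)⁻¹ * Fᵀ * K⁻¹) := by
  have hA := posDef_transpose_mul_inv_mul hF hK
  have hM : (K⁻¹)ᵀ = K⁻¹ := by
    simpa [conjTranspose_eq_transpose_of_trivial] using hK.inv.isHermitian.eq
  have hB : ((Fᵀ * K⁻¹ * F)⁻¹)ᵀ = (Fᵀ * K⁻¹ * F)⁻¹ := by
    simpa only [conjTranspose_eq_transpose_of_trivial] using hA.inv.isHermitian.eq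
  have hinv := nonsing_inv_mul _ ((isUnit_iff_isUnit_det _).mp hA.isUnit)
  unfold Kbar
  set M := K⁻¹
  set B := (Fᵀ * M * F)⁻¹
  have hBAB (X : Matrix (Fin p) (Fin n) ℝ) : B * (Fᵀ * (M * (F * X))) = X := by
    simpa only [Matrix.mul_assoc, Matrix.one_mul] using congrArg (· * X) hinv
  simp only [transpose_sub, transpose_mul, transpose_one, transpose_transpose, hM, hB,
    Matrix.mul_sub, Matrix.sub_mul, Matrix.mul_one, Matrix.one_mul, Matrix.mul_assoc, hBAB]
  abel

theorem Kbar_diag_pos (hF : F.rank = p) (hK : K.PosDef) {i : Fin n}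
    (hi : Pi.single i (1 : ℝ) ∉ LinearMap.range (mulVecLin F)) : 0 < Kbar F K i i := by
  rw [Kbar_eq_transpose_mul_mul hF hK]
  set P := 1 - F * (Fᵀ * K⁻¹ * F)⁻¹ * Fᵀ * K⁻¹ with hP
  have hv : P *ᵥ Pi.single i 1 ≠ 0 := by
    intro h0
    refine hi ⟨((Fᵀ * K⁻¹ * F)⁻¹ * Fᵀ * K⁻¹) *ᵥ Pi.single i 1, ?_⟩
    rw [hP, sub_mulVec, one_mulVec, sub_eq_zero] at h0
    rw [mulVecLin_apply, mulVec_mulVec, ← Matrix.mul_assoc, ← Matrix.mul_assoc]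
    exact h0.symm
  have h := hK.inv.dotProduct_mulVec_pos hv
  have e : (Pᵀ * K⁻¹ * P) i i = star (P *ᵥ Pi.single i 1) ⬝ᵥ K⁻¹ *ᵥ P *ᵥ Pi.single i 1 := by
    rw [star_trivial, mulVec_mulVec, ← vecMul_transpose P, ← dotProduct_mulVec, mulVec_mulVec,
      ← Matrix.mul_assoc]
    simp
  rwa [e]

theorem Kbar_smul {c : ℝ} (hc : c ≠ 0) (hF : F.rank = p) (hK : K.PosDef) :
    Kbar F (c • K) = c⁻¹ • Kbar F K := by
  have hs {m : ℕ} {A : Matrix (Fin m) (Fin m) ℝ} {d : ℝ} (hd : d ≠ 0) (hA : A.PosDef) :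
      (d • A)⁻¹ = d⁻¹ • A⁻¹ :=
    inv_smul' A (Units.mk0 d hd) ((isUnit_iff_isUnit_det _).mp hA.isUnit)
  unfold Kbar
  rw [hs hc hK]
  simp only [Matrix.mul_smul, Matrix.smul_mul]
  rw [hs (inv_ne_zero hc) (posDef_transpose_mul_inv_mul hF hK)]
  simp only [Matrix.mul_smul, Matrix.smul_mul, smul_sub, smul_smul, inv_inv]
  rw [inv_mul_cancel₀ hc, mul_one]

theorem standardized_Kbar_smul {c : ℝ} (hc : 0 < c) (hF : F.rank = p) (hK : K.PosDef)
    (y : Fin n → ℝ) (i : Fin n) :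
    (Kbar F (c⁻¹ • K) *ᵥ y) i / √(Kbar F (c⁻¹ • K) i i) =
      √c * ((Kbar F K *ᵥ y) i / √(Kbar F K i i)) := by
  rw [Kbar_smul (inv_ne_zero hc.ne') hF hK, inv_inv, smul_mulVec, Pi.smul_apply, Matrix.smul_apply,
    smul_eq_mul, smul_eq_mul, Real.sqrt_mul hc.le, mul_div_mul_comm, Real.div_sqrt]

theorem Kbar_one : Kbar F 1 = 1 - F * (Fᵀ * F)⁻¹ * Fᵀ := by
  simp [Kbar]

end Kbar

/-- Existence of a coverage-matching amplitude (lower-quantile case):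
if `k_ε = #{i : (Πy)ᵢ/√(Πᵢᵢ) ≤ σ_ε q} > na`, then `ψ⁻_δ(σ²) = a` for some
`σ² > 0`, where `K(σ²) = σ²R + σ_ε²Iₙ`. -/
theorem stmt12 (n p : ℕ) (hp : 0 < p) (hpn : p < n)
    (F : Matrix (Fin n) (Fin p) ℝ) (hF : F.rank = p)
    (hH2 : ∀ i : Fin n, Pi.single i (1 : ℝ) ∉ LinearMap.range (Matrix.mulVecLin F))
    (y : Fin n → ℝ) (R : Matrix (Fin n) (Fin n) ℝ) (hR : R.PosDef)
    (sigeps : ℝ) (hsig : 0 < sigeps)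
    (a : ℝ) (ha : a ∈ Set.Ioo (0 : ℝ) (1 / 2))
    (q : ℝ) (hq : q < 0) (δ : ℝ) (hδ : 0 < δ) (hδq : δ < -q)
    (hke : (n : ℝ) * a < ((Finset.univ.filter fun i : Fin n =>
        (((1 : Matrix (Fin n) (Fin n) ℝ) - F * (Fᵀ * F)⁻¹ * Fᵀ) *ᵥ y) i /
          Real.sqrt (((1 : Matrix (Fin n) (Fin n) ℝ) - F * (Fᵀ * F)⁻¹ * Fᵀ) i i)
          ≤ sigeps * q).card : ℝ)) :
    ∃ s : ℝ, 0 < s ∧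
      psiMinus F y δ q (s • R + (sigeps ^ 2) • (1 : Matrix (Fin n) (Fin n) ℝ)) = a := by
  obtain ⟨ha0, -⟩ := ha
  have hn : (0 : ℝ) < n := by exact_mod_cast hp.trans hpn
  have hσ : 0 < sigeps ^ 2 := by positivity
  set I : Matrix (Fin n) (Fin n) ℝ := 1 with hI
  have hIpos : I.PosDef := PosDef.one
  set K : ℝ → Matrix (Fin n) (Fin n) ℝ := fun u => u • R + ((1 - u) * sigeps ^ 2) • I with hKdef
  have hK : ∀ u ∈ Set.Icc (0 : ℝ) 1, (K u).PosDef := by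
    rintro u ⟨h0, h1⟩
    rcases h0.eq_or_lt with rfl | h0
    · simpa [hKdef] using hIpos.smul hσ
    · exact (hR.smul h0).add_posSemidef
        (hIpos.posSemidef.smul (mul_nonneg (by linarith) hσ.le))
  set r : ℝ → Fin n → ℝ := fun u i => (Kbar F (K u) *ᵥ y) i / √(Kbar F (K u) i i) with hr
  set g : ℝ → ℝ := fun u => (1 / n) * ∑ i, hminus δ (q - √(1 - u) * r u i) with hg
  have hrc (i : Fin n) : ContinuousOn (fun u => r u i) (Set.Icc 0 1) := by
    intro u hu
    have hKc : Continuous K := by fun_prop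
    have hc : ContinuousAt (fun u => Kbar F (K u)) u :=
      (continuousAt_Kbar hF (hK u hu)).comp hKc.continuousAt
    refine ContinuousAt.continuousWithinAt (ContinuousAt.div ?_ ?_ ?_)
    · exact ((continuous_apply i).comp
        (continuous_id.matrix_mulVec continuous_const)).continuousAt.comp hc
    · exact (Real.continuous_sqrt.comp
        (continuous_id.matrix_elem i i)).continuousAt.comp hc
    · exact (Real.sqrt_pos.mpr (Kbar_diag_pos hF (hK u hu) (hH2 i))).ne'
  have hgc : ContinuousOn g (Set.Icc 0 1) := by
    refine continuousOn_const.mul (continuousOn_finsetSum _ fun i _ => ?_)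
    refine (continuous_hminus hδ).comp_continuousOn (continuousOn_const.sub (.mul ?_ (hrc i)))
    fun_prop
  have hg1 : g 1 < a := by
    have : hminus δ q = 0 := by
      rw [hminus, if_neg (by linarith), if_neg (by linarith)]
    simpa [hg, this] using ha0
  have hr0 (i : Fin n) : r 0 i = sigeps⁻¹ *
      (((I - F * (Fᵀ * F)⁻¹ * Fᵀ) *ᵥ y) i / √((I - F * (Fᵀ * F)⁻¹ * Fᵀ) i i)) := by
    have h := standardized_Kbar_smul (inv_pos.mpr hσ) hF hIpos y i
    rw [inv_inv, Real.sqrt_inv, Real.sqrt_sq hsig.le, hI, Kbar_one, ← hI] at h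
    rw [← h]
    simp [hr, hKdef]
  have hg0 : a < g 0 := by
    rw [hg]
    beta_reduce
    rw [one_div, lt_inv_mul_iff₀ hn]
    refine hke.trans_le ?_
    rw [← Finset.sum_boole]
    refine Finset.sum_le_sum fun i _ => ?_
    split_ifs with h
    · have h' : r 0 i ≤ q := by rwa [hr0, inv_mul_le_iff₀ hsig]
      rw [hminus, if_pos (by simpa using h')]
    · exact hminus_nonneg hδ _
  obtain ⟨u, hu, hgu⟩ := intermediate_value_Icc' zero_le_one hgc ⟨hg1.le, hg0.le⟩
  have hu0 : 0 < u := hu.1.lt_of_ne (by rintro rfl; exact hg0.ne' hgu)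
  have hu1 : 0 < 1 - u := sub_pos.mpr (hu.2.lt_of_ne (by rintro rfl; exact hg1.ne hgu))
  refine ⟨u / (1 - u), div_pos hu0 hu1, ?_⟩
  have hKu : (u / (1 - u)) • R + sigeps ^ 2 • I = (1 - u)⁻¹ • K u := by
    rw [hKdef, smul_add, smul_smul, smul_smul, inv_mul_cancel_left₀ hu1.ne', div_eq_inv_mul]
  rw [hKu, psiMinus, ← hgu]
  simp only [standardized_Kbar_smul hu1 hF (hK u hu), hg, hr]
end

section
/- Let W be a real n×(n−p) matrix with WᵀW = I_{n−p} and FᵀW = 0, let Π = WWᵀ, and fix y ∈ ℝⁿ. For a real symmetric positive definite n×n matrix R set R̄ = W(WᵀRW)⁻¹Wᵀ. Then there exists ε > 0 such that for every real symmetric positive definite n×n matrix R with ‖R − Iₙ‖ < ε (Frobenius norm), Card{ i : (R̄y)ᵢ ≤ 0 } ≤ Card{ i : (Πy)ᵢ ≤ 0 }. -/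
open Matrix

/-- Matrix inversion is continuous at matrices with nonzero determinant. -/
lemma Matrix.continuousAt_inv_of_det_ne_zero {m : Type*} [Fintype m] [DecidableEq m]
    {A : Matrix m m ℝ} (hA : A.det ≠ 0) :
    ContinuousAt (fun B : Matrix m m ℝ => B⁻¹) A := by
  simp only [Matrix.inv_def, Ring.inverse_eq_inv']
  exact (continuous_id.matrix_det.continuousAt.inv₀ hA).smul
    continuous_id.matrix_adjugate.continuousAt

/-- Every neighbourhood of a matrix contains a Frobenius ball. -/
lemma Matrix.exists_frobenius_ball_of_eventually_nhds {m k : Type*} [Fintype m] [Fintype k]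
    {A : Matrix m k ℝ} {P : Matrix m k ℝ → Prop} (hP : ∀ᶠ B in nhds A, P B) :
    ∃ ε : ℝ, 0 < ε ∧ ∀ B : Matrix m k ℝ,
      Real.sqrt (∑ i, ∑ j, (B i j - A i j) ^ 2) < ε → P B := by
  obtain ⟨ε, hε, h⟩ := (Metric.eventually_nhds_iff (α := m → k → ℝ)).mp hP
  refine ⟨ε, hε, fun B hB => h ?_⟩
  refine (dist_pi_lt_iff hε).mpr fun i => (dist_pi_lt_iff hε).mpr fun j => ?_
  rw [Real.dist_eq]
  refine lt_of_le_of_lt (Real.abs_le_sqrt ?_) hB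
  calc (B i j - A i j) ^ 2 ≤ ∑ j, (B i j - A i j) ^ 2 :=
        Finset.single_le_sum (f := fun j => (B i j - A i j) ^ 2)
          (fun _ _ => sq_nonneg _) (Finset.mem_univ j)
    _ ≤ ∑ i, ∑ j, (B i j - A i j) ^ 2 :=
        Finset.single_le_sum (f := fun i => ∑ j, (B i j - A i j) ^ 2)
          (fun _ _ => Finset.sum_nonneg fun _ _ => sq_nonneg _) (Finset.mem_univ i)

/-- For `R̄ = W(WᵀRW)⁻¹Wᵀ` and `Π = WWᵀ`: for all symmetric positive definite
`R` close enough to the identity in Frobenius norm, the number of indices with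
`(R̄y)ᵢ ≤ 0` is at most the number of indices with `(Πy)ᵢ ≤ 0`. -/
theorem stmt16 (n p : ℕ) (hp : 0 < p) (hpn : p < n)
    (F : Matrix (Fin n) (Fin p) ℝ) (hF : F.rank = p)
    (W : Matrix (Fin n) (Fin (n - p)) ℝ)
    (hW1 : Wᵀ * W = 1) (hW2 : Fᵀ * W = 0)
    (y : Fin n → ℝ) :
    ∃ ε : ℝ, 0 < ε ∧
      ∀ R : Matrix (Fin n) (Fin n) ℝ, R.PosDef →
        Real.sqrt (∑ i, ∑ j, (R i j - (1 : Matrix (Fin n) (Fin n) ℝ) i j) ^ 2) < ε →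
        (Finset.univ.filter fun i : Fin n =>
            ((W * (Wᵀ * R * W)⁻¹ * Wᵀ) *ᵥ y) i ≤ 0).card ≤
          (Finset.univ.filter fun i : Fin n => ((W * Wᵀ) *ᵥ y) i ≤ 0).card := by
  have hcont : ContinuousAt (fun R : Matrix (Fin n) (Fin n) ℝ =>
      (W * (Wᵀ * R * W)⁻¹ * Wᵀ) *ᵥ y) 1 := by
    have hinv : ContinuousAt (fun R : Matrix (Fin n) (Fin n) ℝ => (Wᵀ * R * W)⁻¹) 1 := by
      refine ContinuousAt.comp (g := fun B : Matrix (Fin (n - p)) (Fin (n - p)) ℝ => B⁻¹)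
        (f := fun R : Matrix (Fin n) (Fin n) ℝ => Wᵀ * R * W)
        (Matrix.continuousAt_inv_of_det_ne_zero ?_) (by fun_prop)
      simp [hW1]
    have hmul : Continuous fun B : Matrix (Fin (n - p)) (Fin (n - p)) ℝ =>
        (W * B * Wᵀ) *ᵥ y := by fun_prop
    exact hmul.continuousAt.comp hinv
  have hpos : ∀ᶠ R in nhds (1 : Matrix (Fin n) (Fin n) ℝ), ∀ i,
      0 < ((W * Wᵀ) *ᵥ y) i → 0 < ((W * (Wᵀ * R * W)⁻¹ * Wᵀ) *ᵥ y) i := by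
    refine Filter.eventually_all.mpr fun i => ?_
    by_cases hi : 0 < ((W * Wᵀ) *ᵥ y) i
    · have hlim := continuousAt_pi.mp hcont i
      refine (hlim.eventually_const_lt ?_).mono fun _ h _ => h
      simpa [hW1] using hi
    · exact Filter.Eventually.of_forall fun _ h => absurd h hi
  obtain ⟨ε, hε, h⟩ := Matrix.exists_frobenius_ball_of_eventually_nhds hpos
  refine ⟨ε, hε, fun R _ hR => Finset.card_le_card fun i => ?_⟩
  simp only [Finset.mem_filter, Finset.mem_univ, true_and]
  intro hi
  by_contra! hneg
  exact absurd (h R hR i hneg) hi.not_gt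
end
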